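/- arXiv:2301.04759 — 4 statements merged into one kernel-verified Lean document; each statement's English description precedes it below -/
import Mathlib

section
/- For every integer k with 0 ≤ k ≤ d−1 and every s ∈ ℂ with Re s > 0, the Omega function satisfies the functional equation Ω_k(s+d) + α_{d−1} Ω_k(s+d−1) + … + α_1 Ω_k(s+1) = s·Ω_k(s), where α_l = −l·a_l. -/
/-- The polynomial `P₀(t) = -t^d/d + ∑_{k=1}^{d-1} a_k t^k`. -/
noncomputable def P0 (d : ℕ) (a : ℕ → ℂ) (t : ℂ) : ℂ :=
  -t ^ d / (d : ℂ) + ∑ k ∈ Finset.Ico 1 d, a k * t ^ k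

/-- The Omega function `Ω_k(s) = e^{2πiks/d} ∫_0^∞ u^{s-1} e^{P₀(ω_k u)} du`, for `Re s > 0`,
where `ω_k = e^{2πik/d}` and `u^{s-1} = exp((s-1) log u)` for real `u > 0`. -/
noncomputable def OmegaFn (d : ℕ) (a : ℕ → ℂ) (k : ℕ) (s : ℂ) : ℂ :=
  Complex.exp (2 * Real.pi * Complex.I * k * s / d) *
    ∫ u in Set.Ioi (0 : ℝ),
      (u : ℂ) ^ (s - 1) *
        Complex.exp (P0 d a (Complex.exp (2 * Real.pi * Complex.I * k / d) * u))

section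

open Set Filter Topology MeasureTheory Asymptotics

lemma hasDerivAt_P0 {d : ℕ} (hd : d ≠ 0) (a : ℕ → ℂ) (t : ℂ) :
    HasDerivAt (P0 d a)
      (-t ^ (d - 1) + ∑ l ∈ Finset.Ico 1 d, a l * (l * t ^ (l - 1))) t := by
  have hd' : (d : ℂ) ≠ 0 := Nat.cast_ne_zero.2 hd
  have h1 : HasDerivAt (fun t : ℂ => -t ^ d / (d : ℂ)) (-t ^ (d - 1)) t := by
    convert! (hasDerivAt_pow d t).neg.div_const (d : ℂ) using 1
    field_simp
  exact h1.add (HasDerivAt.fun_sum fun l _ => (hasDerivAt_pow l t).const_mul (a l))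

lemma continuous_P0 {d : ℕ} (a : ℕ → ℂ) : Continuous (P0 d a) := by
  unfold P0
  fun_prop

/-- On a ray through a `d`-th root of unity, `exp ∘ P₀` decays exponentially. -/
lemma isBigO_exp_P0 {d : ℕ} (hd : d ≠ 0) (a : ℕ → ℂ) {ω : ℂ} (hω : ω ^ d = 1) :
    (fun u : ℝ => Complex.exp (P0 d a (ω * u)))
      =O[atTop] fun u : ℝ => Real.exp (-(1 / (2 * d) : ℝ) * u) := by
  have hd0 : (0 : ℝ) < d := Nat.cast_pos.2 (Nat.pos_of_ne_zero hd)
  have hlower : (fun u : ℝ => ∑ l ∈ Finset.Ico 1 d, a l * (ω * u) ^ l)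
      =o[atTop] fun u : ℝ => u ^ d := by
    refine IsLittleO.fun_sum fun l hl => ?_
    have h : (fun u : ℝ => (u : ℂ) ^ l) =o[atTop] fun u : ℝ => u ^ d := by
      refine IsLittleO.of_norm_left ?_
      simpa using (isLittleO_pow_pow_atTop_of_lt (𝕜 := ℝ) (Finset.mem_Ico.1 hl).2).norm_left
    simpa only [mul_pow, mul_assoc] using h.const_mul_left (a l * ω ^ l)
  refine IsBigO.of_bound 1 ?_
  filter_upwards [hlower.bound (show (0 : ℝ) < 1 / (2 * d) by positivity), eventually_ge_atTop 1]
    with u hu hu1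
  have hre : (P0 d a (ω * u)).re
      = -u ^ d / d + (∑ l ∈ Finset.Ico 1 d, a l * (ω * u) ^ l).re := by
    rw [P0, Complex.add_re, mul_pow ω _ d, hω, one_mul]
    norm_cast
  have hpow : u ≤ u ^ d := le_self_pow₀ hu1 hd
  rw [one_mul, Complex.norm_exp, Real.norm_eq_abs, Real.abs_exp, Real.exp_le_exp, hre]
  rw [Real.norm_of_nonneg (by positivity : (0 : ℝ) ≤ u ^ d)] at hu
  have hle := (Complex.re_le_norm _).trans hu
  have hmul : 1 / (2 * d) * u ≤ 1 / (2 * d) * u ^ d := by gcongr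
  have heq : -u ^ d / d = -(2 * (1 / (2 * d) * u ^ d)) := by field_simp
  linarith

lemma integrableOn_cpow_mul_exp_P0 {d : ℕ} (hd : d ≠ 0) (a : ℕ → ℂ) {ω : ℂ} (hω : ω ^ d = 1)
    {s : ℂ} (hs : 0 < s.re) :
    IntegrableOn (fun u : ℝ => (u : ℂ) ^ (s - 1) * Complex.exp (P0 d a (ω * u))) (Ioi 0) := by
  have hcont : Continuous fun u : ℝ => Complex.exp (P0 d a (ω * u)) :=
    Complex.continuous_exp.comp ((continuous_P0 a).comp (by fun_prop))
  have h := mellinConvergent_of_isBigO_rpow_exp (s := s) (b := 0)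
    (show (0 : ℝ) < 1 / (2 * d) by positivity)
    (hcont.locallyIntegrable.locallyIntegrableOn _) (isBigO_exp_P0 hd a hω)
    (by
      simpa using (hcont.continuousAt (x := 0)).tendsto.isBigO_one ℝ |>.mono nhdsWithin_le_nhds) hs
  simpa [MellinConvergent] using h

lemma tendsto_cpow_mul_exp_P0 {d : ℕ} (hd : d ≠ 0) (a : ℕ → ℂ) {ω : ℂ} (hω : ω ^ d = 1) (s : ℂ) :
    Tendsto (fun u : ℝ => (u : ℂ) ^ s * Complex.exp (P0 d a (ω * u))) atTop (𝓝 0) := by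
  have hcpow : (fun u : ℝ => (u : ℂ) ^ s)
      =o[atTop] fun u : ℝ => Real.exp ((1 / (2 * d) : ℝ) * u) := by
    refine IsLittleO.of_norm_left ?_
    refine (isLittleO_rpow_exp_pos_mul_atTop s.re
      (show (0 : ℝ) < 1 / (2 * d) by positivity)).congr' ?_ EventuallyEq.rfl
    filter_upwards [eventually_gt_atTop 0] with u hu
    rw [Complex.norm_cpow_eq_rpow_re_of_pos hu]
  have h := hcpow.mul_isBigO (isBigO_exp_P0 hd a hω)
  refine (isLittleO_one_iff ℝ).1 (h.congr_right fun u => ?_)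
  rw [← Real.exp_add]
  simp

/-- Integration by parts for the Mellin-type integrals of `exp ∘ P₀` along the ray through `ω`. -/
lemma integral_cpow_mul_exp_P0_recurrence {d : ℕ} (hd : d ≠ 0) (a : ℕ → ℂ) {ω : ℂ}
    (hω : ω ^ d = 1) {s : ℂ} (hs : 0 < s.re) :
    s * (∫ u in Ioi (0 : ℝ), (u : ℂ) ^ (s - 1) * Complex.exp (P0 d a (ω * u)))
      - ω ^ d * (∫ u in Ioi (0 : ℝ), (u : ℂ) ^ (s + d - 1) * Complex.exp (P0 d a (ω * u)))
      + ∑ l ∈ Finset.Ico 1 d, a l * l * ω ^ l *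
          (∫ u in Ioi (0 : ℝ), (u : ℂ) ^ (s + l - 1) * Complex.exp (P0 d a (ω * u))) = 0 := by
  have hs0 : s ≠ 0 := by
    rintro rfl
    simp at hs
  have hint (n : ℕ) : IntegrableOn
      (fun u : ℝ => (u : ℂ) ^ (s + n - 1) * Complex.exp (P0 d a (ω * u))) (Ioi 0) :=
    integrableOn_cpow_mul_exp_P0 hd a hω (by
      rw [Complex.add_re, Complex.natCast_re]
      positivity)
  have hint0 := integrableOn_cpow_mul_exp_P0 hd a hω hs
  have hsum := integrable_finsetSum (Finset.Ico 1 d)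
    fun l _ => (hint l).const_mul (a l * l * ω ^ l)
  have hdiff := (hint0.const_mul s).sub ((hint d).const_mul (ω ^ d))
  have hpow {u : ℝ} (hu : 0 < u) {n : ℕ} (hn : n ≠ 0) :
      (u : ℂ) ^ (s + n - 1) = (u : ℂ) ^ s * (u : ℂ) ^ (n - 1) := by
    rw [← Complex.cpow_natCast, ← Complex.cpow_add _ _ (by exact_mod_cast hu.ne'),
      Nat.cast_sub (Nat.one_le_iff_ne_zero.2 hn), Nat.cast_one, add_sub_assoc]
  have hcont : Continuous fun u : ℝ => (u : ℂ) ^ s * Complex.exp (P0 d a (ω * u)) :=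
    (Complex.continuous_ofReal_cpow_const hs).mul
      (Complex.continuous_exp.comp ((continuous_P0 a).comp (by fun_prop)))
  have key := integral_Ioi_of_hasDerivAt_of_tendsto hcont.continuousWithinAt
    (fun u (hu : 0 < u) => ?_) (hdiff.add hsum) (tendsto_cpow_mul_exp_P0 hd a hω s)
  · rw [integral_add' hdiff hsum, integral_sub' (hint0.const_mul s) ((hint d).const_mul (ω ^ d)),
      integral_finsetSum _ fun l _ => (hint l).const_mul (a l * l * ω ^ l)] at key
    simpa only [integral_const_mul, Complex.ofReal_zero, Complex.zero_cpow hs0, zero_mul,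
      sub_zero] using key
  · have hP : HasDerivAt (fun u : ℝ => P0 d a (ω * u)) _ u :=
      ((hasDerivAt_P0 hd a (ω * u)).comp (u : ℂ)
        ((hasDerivAt_id (u : ℂ)).const_mul ω)).comp_ofReal
    convert! (hasDerivAt_ofReal_cpow_const hu.ne' hs0).mul hP.cexp using 1
    have hterm : ∀ l ∈ Finset.Ico 1 d,
        a l * l * ω ^ l * ((u : ℂ) ^ (s + l - 1) * Complex.exp (P0 d a (ω * u)))
          = (u : ℂ) ^ s * Complex.exp (P0 d a (ω * u)) * ω *
              (a l * (l * (ω * u) ^ (l - 1))) := by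
      intro l hl
      have hl0 : l ≠ 0 := Nat.one_le_iff_ne_zero.1 (Finset.mem_Ico.1 hl).1
      rw [hpow hu hl0, mul_pow, ← mul_pow_sub_one hl0 ω]
      ring
    simp only [Pi.add_apply, Pi.sub_apply]
    rw [Finset.sum_congr rfl hterm, ← Finset.mul_sum, hpow hu hd, ← mul_pow_sub_one hd ω, mul_pow]
    ring

lemma exp_two_pi_mul_add_natCast_div (d k n : ℕ) (s : ℂ) :
    Complex.exp (2 * Real.pi * Complex.I * k * (s + n) / d)
      = Complex.exp (2 * Real.pi * Complex.I * k * s / d) *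
          Complex.exp (2 * Real.pi * Complex.I * k / d) ^ n := by
  rw [← Complex.exp_nat_mul, ← Complex.exp_add]
  ring_nf

end

/-- For every `0 ≤ k ≤ d-1` and every `s` with `Re s > 0`,
`Ω_k(s+d) + ∑_{l=1}^{d-1} α_l Ω_k(s+l) = s · Ω_k(s)`, where `α_l = -l·a_l`. -/
theorem stmt0 (d : ℕ) (hd : 1 ≤ d) (a : ℕ → ℂ) (α : ℕ → ℂ)
    (hα : ∀ l, α l = -(l : ℂ) * a l)
    (k : ℕ) (hk : k ≤ d - 1) (s : ℂ) (hs : 0 < s.re) :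
    OmegaFn d a k (s + d) + ∑ l ∈ Finset.Ico 1 d, α l * OmegaFn d a k (s + l)
      = s * OmegaFn d a k s := by
  have hω : Complex.exp (2 * Real.pi * Complex.I * k / d) ^ d = 1 := by
    have hd0 : (d : ℂ) ≠ 0 := Nat.cast_ne_zero.2 (Nat.one_le_iff_ne_zero.1 hd)
    rw [← Complex.exp_nat_mul, mul_div_cancel₀ _ hd0, mul_comm]
    exact Complex.exp_nat_mul_two_pi_mul_I k
  have key := integral_cpow_mul_exp_P0_recurrence (Nat.one_le_iff_ne_zero.1 hd) a hω hs
  simp only [OmegaFn, exp_two_pi_mul_add_natCast_div, hα]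
  rw [← sub_eq_zero, ← neg_eq_zero,
    ← mul_zero (Complex.exp (2 * Real.pi * Complex.I * k * s / d)), ← key, mul_add, Finset.mul_sum,
    neg_sub, sub_add_eq_sub_sub, sub_eq_add_neg _ (∑ l ∈ _, _), ← Finset.sum_neg_distrib]
  congr 1
  · ring
  · exact Finset.sum_congr rfl fun l _ => by ring
end

section
/- For each 0 ≤ k ≤ d−1 there exists a function F_k meromorphic on all of ℂ such that: F_k(s) = Ω_k(s) for all s with Re s > 0; F_k is holomorphic on ℂ ∖ {0, −1, −2, …}; every pole of F_k is a simple pole located at a nonpositive integer; and F_k satisfies s·F_k(s) = F_k(s+d) + Σ_{l=1}^{d−1} α_l F_k(s+l) at every s where all terms are defined. -/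
section Continuation

open Filter Topology MeasureTheory Set

/-- The operator sending `g` to `s ↦ ∑_{l=1}^d β_l(s) g(s + l)`. -/
def shiftOp (d : ℕ) (β : ℕ → ℂ → ℂ) (g : ℂ → ℂ) (s : ℂ) : ℂ :=
  ∑ l ∈ Finset.Ico 1 (d + 1), β l s * g (s + l)

lemma shiftOp_congr {d : ℕ} {β : ℕ → ℂ → ℂ} {g h : ℂ → ℂ} {x : ℝ}
    (H : ∀ s : ℂ, x < s.re → g s = h s) {s : ℂ} (hs : x - 1 < s.re) :
    shiftOp d β g s = shiftOp d β h s := by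
  refine Finset.sum_congr rfl fun l hl => ?_
  have hl1 : (1 : ℝ) ≤ l := by exact_mod_cast (Finset.mem_Ico.1 hl).1
  rw [H (s + l) (by simp; linarith)]

lemma differentiableAt_shiftOp {d : ℕ} {β : ℕ → ℂ → ℂ} (hβ : ∀ l, Differentiable ℂ (β l))
    {g : ℂ → ℂ} {x : ℝ} (hg : ∀ s : ℂ, x < s.re → DifferentiableAt ℂ g s)
    {s : ℂ} (hs : x - 1 < s.re) : DifferentiableAt ℂ (shiftOp d β g) s := by
  unfold shiftOp
  refine DifferentiableAt.fun_sum fun l hl => ?_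
  have hl1 : (1 : ℝ) ≤ l := by exact_mod_cast (Finset.mem_Ico.1 hl).1
  refine (hβ l s).mul ?_
  exact (hg (s + l) (by simp; linarith)).comp s (differentiableAt_id.add_const (l : ℂ))

/-- A holomorphic solution of `h = ∑_{l=1}^d β_l h(· + l)` on the right half-plane, with entire
coefficients, extends to an entire solution. -/
lemma exists_entire_extension {d : ℕ} {β : ℕ → ℂ → ℂ} (hβ : ∀ l, Differentiable ℂ (β l))
    {h : ℂ → ℂ} (hh : ∀ s : ℂ, 0 < s.re → DifferentiableAt ℂ h s)
    (heq : ∀ s : ℂ, 0 < s.re → h s = shiftOp d β h s) :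
    ∃ H : ℂ → ℂ, Differentiable ℂ H ∧ (∀ s : ℂ, 0 < s.re → H s = h s) ∧
      ∀ s, H s = shiftOp d β H s := by
  set T := fun n : ℕ => (shiftOp d β)^[n] h with hT
  have hsucc (n : ℕ) : T (n + 1) = shiftOp d β (T n) := Function.iterate_succ_apply' _ _ _
  have hdiff (n : ℕ) : ∀ s : ℂ, -(n : ℝ) < s.re → DifferentiableAt ℂ (T n) s := by
    induction n with
    | zero => intro s hs; exact hh s (by simpa using hs)
    | succ n ih =>
      intro s hs
      rw [hsucc]
      exact differentiableAt_shiftOp hβ ih (by push_cast at hs; linarith)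
  have hstep (n : ℕ) : ∀ s : ℂ, -(n : ℝ) < s.re → T (n + 1) s = T n s := by
    induction n with
    | zero => intro s hs; exact (heq s (by simpa using hs)).symm
    | succ n ih =>
      intro s hs
      rw [hsucc (n + 1), shiftOp_congr ih (by push_cast at hs; linarith), hsucc n]
  have hmono (n m : ℕ) : ∀ s : ℂ, -(n : ℝ) < s.re → T (n + m) s = T n s := by
    induction m with
    | zero => intro s _; rfl
    | succ m ih =>
      intro s hs
      rw [← add_assoc, hstep (n + m) s (by push_cast; linarith [(m.cast_nonneg : (0 : ℝ) ≤ m)]),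
        ih s hs]
  have hN (s : ℂ) : -((⌊-s.re⌋₊ + 1 : ℕ) : ℝ) < s.re := by
    have := Nat.lt_floor_add_one (-s.re)
    push_cast
    linarith
  have hH (n : ℕ) (s : ℂ) (hs : -(n : ℝ) < s.re) : T (⌊-s.re⌋₊ + 1) s = T n s := by
    rcases le_total n (⌊-s.re⌋₊ + 1) with hle | hle
    · obtain ⟨m, hm⟩ := Nat.exists_eq_add_of_le hle
      rw [hm, hmono n m s hs]
    · obtain ⟨m, hm⟩ := Nat.exists_eq_add_of_le hle
      rw [hm, hmono _ m s (hN s)]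
  refine ⟨fun s => T (⌊-s.re⌋₊ + 1) s, fun s => ?_, fun s hs => ?_, fun s => ?_⟩
  · refine (hdiff _ s (hN s)).congr_of_eventuallyEq ?_
    filter_upwards [(isOpen_lt continuous_const Complex.continuous_re).mem_nhds (hN s)] with z hz
    exact hH _ z hz
  · exact hH 0 s (by simpa using hs)
  · rw [shiftOp_congr (hH (⌊-s.re⌋₊ + 1)) (by linarith [hN s]), ← hsucc]
    exact (hstep _ s (hN s)).symm

lemma Gamma_add_natCast {s : ℂ} (hs : ∀ n : ℕ, s ≠ -(n : ℂ)) (m : ℕ) :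
    Complex.Gamma (s + m) = (∏ j ∈ Finset.range m, (s + j)) * Complex.Gamma s := by
  induction m with
  | zero => simp
  | succ m ih =>
    rw [Nat.cast_succ, ← add_assoc, Complex.Gamma_add_one _ fun h => hs m (by linear_combination h),
      ih, Finset.prod_range_succ]
    ring

lemma exists_tendsto_add_mul_Gamma (n : ℕ) : ∃ r : ℂ,
    Tendsto (fun s => (s + (n : ℂ)) * Complex.Gamma s) (𝓝[≠] (-(n : ℂ))) (𝓝 r) := by
  induction n with
  | zero => exact ⟨1, by simpa using Complex.tendsto_self_mul_Gamma_nhds_zero⟩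
  | succ n ih =>
    obtain ⟨r, hr⟩ := ih
    have hne : (-((n + 1 : ℕ) : ℂ)) ≠ 0 := neg_ne_zero.2 (Nat.cast_ne_zero.2 n.succ_ne_zero)
    have hshift : Tendsto (fun s : ℂ => s + 1) (𝓝[≠] (-((n + 1 : ℕ) : ℂ))) (𝓝[≠] (-(n : ℂ))) := by
      refine tendsto_nhdsWithin_iff.2 ⟨?_, ?_⟩
      · refine Tendsto.mono_left ?_ nhdsWithin_le_nhds
        convert (continuous_add_const (1 : ℂ)).tendsto (-((n + 1 : ℕ) : ℂ)) using 2
        push_cast; simp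
      · filter_upwards [self_mem_nhdsWithin] with s hs h
        refine hs ?_
        simp only [mem_singleton_iff] at h ⊢
        push_cast
        linear_combination h
    have hinv : Tendsto (fun s : ℂ => s) (𝓝[≠] (-((n + 1 : ℕ) : ℂ))) (𝓝 (-((n + 1 : ℕ) : ℂ))) :=
      tendsto_id.mono_left nhdsWithin_le_nhds
    refine ⟨_, ((hr.comp hshift).div hinv hne).congr' ?_⟩
    filter_upwards [hinv.eventually_ne hne] with s hs
    simp only [Function.comp, Pi.div_apply, Complex.Gamma_add_one s hs]
    field_simp
    push_cast
    ring

/-- A holomorphic solution of `s g(s) = ∑_{l=1}^d c_l g(s + l)` on the right half-plane extends to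
a meromorphic solution with at most simple poles, at the nonpositive integers. -/
lemma exists_meromorphic_extension {d : ℕ} {c : ℕ → ℂ} {g : ℂ → ℂ}
    (hg : ∀ s : ℂ, 0 < s.re → DifferentiableAt ℂ g s)
    (heq : ∀ s : ℂ, 0 < s.re → s * g s = ∑ l ∈ Finset.Ico 1 (d + 1), c l * g (s + l)) :
    ∃ F : ℂ → ℂ, (∀ s : ℂ, 0 < s.re → F s = g s) ∧
      DifferentiableOn ℂ F {s : ℂ | ∀ n : ℕ, s ≠ -(n : ℂ)} ∧
      (∀ n : ℕ, ∃ r : ℂ, Tendsto (fun s => (s + (n : ℂ)) * F s) (𝓝[≠] (-(n : ℂ))) (𝓝 r)) ∧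
      ∀ s : ℂ, (∀ n : ℕ, s ≠ -(n : ℂ)) →
        s * F s = ∑ l ∈ Finset.Ico 1 (d + 1), c l * F (s + l) := by
  have hpos {s : ℂ} (hs : 0 < s.re) (n : ℕ) : s ≠ -(n : ℂ) := by
    rintro rfl
    simp at hs
    linarith [(n.cast_nonneg : (0 : ℝ) ≤ n)]
  set β : ℕ → ℂ → ℂ := fun l s => c l * ∏ j ∈ Finset.range (l - 1), (s + 1 + j) with hβ
  have hΓ {s : ℂ} (hs : ∀ n : ℕ, s ≠ -(n : ℂ)) {l : ℕ} (hl : l ∈ Finset.Ico 1 (d + 1)) :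
      Complex.Gamma (s + l) =
        s * (∏ j ∈ Finset.range (l - 1), (s + 1 + j)) * Complex.Gamma s := by
    obtain ⟨m, rfl⟩ := Nat.exists_eq_add_of_le' (Finset.mem_Ico.1 hl).1
    rw [Gamma_add_natCast hs, Finset.prod_range_succ']
    simp only [Nat.add_sub_cancel, Nat.cast_zero, add_zero, Nat.cast_succ]
    rw [mul_comm s]
    congr 2
    exact Finset.prod_congr rfl fun j _ => by ring
  obtain ⟨H, hHd, hHg, hHeq⟩ := exists_entire_extension (d := d) (β := β)
    (h := fun s => g s / Complex.Gamma s) (fun l => by simp only [hβ]; fun_prop)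
    (fun s hs => (hg s hs).div (Complex.differentiableAt_Gamma s (hpos hs))
      (Complex.Gamma_ne_zero (hpos hs)))
    (fun s hs => by
      have hs0 : s ≠ 0 := by simpa using hpos hs 0
      have hΓ0 := Complex.Gamma_ne_zero (hpos hs)
      refine mul_left_cancel₀ (mul_ne_zero hs0 hΓ0) ?_
      rw [shiftOp, Finset.mul_sum]
      trans s * g s
      · field_simp
      rw [heq s hs]
      refine Finset.sum_congr rfl fun l hl => ?_
      have hΓl : Complex.Gamma (s + l) ≠ 0 := Complex.Gamma_ne_zero
        (hpos (by simp; linarith [(l.cast_nonneg : (0 : ℝ) ≤ l)]))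
      rw [mul_div_assoc', mul_div_assoc', eq_div_iff hΓl, hΓ (hpos hs) hl]
      ring)
  refine ⟨fun s => Complex.Gamma s * H s, fun s hs => ?_, fun s hs => ?_, fun n => ?_,
    fun s hs => ?_⟩
  · simp only [hHg s hs, mul_div_cancel₀ _ (Complex.Gamma_ne_zero (hpos hs))]
  · exact ((Complex.differentiableAt_Gamma s hs).mul (hHd s)).differentiableWithinAt
  · obtain ⟨r, hr⟩ := exists_tendsto_add_mul_Gamma n
    refine ⟨_, (hr.mul ((hHd.continuous.tendsto _).mono_left nhdsWithin_le_nhds)).congr fun s => ?_⟩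
    rw [mul_assoc]
  · beta_reduce
    rw [hHeq s, shiftOp, Finset.mul_sum, Finset.mul_sum]
    refine Finset.sum_congr rfl fun l hl => ?_
    rw [hΓ hs hl]
    ring

/-- The function `u ↦ exp(-∑_{l=1}^d (b_l / l) u^l)`. -/
noncomputable def expNegPoly (d : ℕ) (b : ℕ → ℂ) (u : ℝ) : ℂ :=
  Complex.exp (-∑ l ∈ Finset.Ico 1 (d + 1), b l / l * (u : ℂ) ^ l)

lemma hasDerivAt_expNegPoly (d : ℕ) (b : ℕ → ℂ) (u : ℝ) :
    HasDerivAt (expNegPoly d b)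
      (expNegPoly d b u * -∑ l ∈ Finset.Ico 1 (d + 1), b l * (u : ℂ) ^ (l - 1)) u := by
  refine HasDerivAt.cexp (HasDerivAt.neg (HasDerivAt.fun_sum fun l hl => ?_))
  have hl0 : (l : ℂ) ≠ 0 := Nat.cast_ne_zero.2 (by have := (Finset.mem_Ico.1 hl).1; omega)
  have hpow := ((hasDerivAt_pow l (u : ℂ)).comp_ofReal).const_mul (b l / l)
  rwa [← mul_assoc, div_mul_cancel₀ _ hl0] at hpow

lemma continuous_expNegPoly (d : ℕ) (b : ℕ → ℂ) : Continuous (expNegPoly d b) :=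
  continuous_iff_continuousAt.2 fun u => (hasDerivAt_expNegPoly d b u).continuousAt

lemma expNegPoly_isBigO_atTop {d : ℕ} (hd : 1 ≤ d) {b : ℕ → ℂ} (hb : b d = 1) :
    expNegPoly d b =O[atTop] fun u : ℝ => Real.exp (-(1 / (2 * d)) * u) := by
  have hd0 : (0 : ℝ) < d := by exact_mod_cast hd
  have hlow : (fun u : ℝ => ∑ l ∈ Finset.Ico 1 d, b l / l * (u : ℂ) ^ l)
      =o[atTop] fun u : ℝ => u ^ d := by
    refine Asymptotics.IsLittleO.fun_sum fun l hl => Asymptotics.IsLittleO.const_mul_left ?_ _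
    refine Asymptotics.IsLittleO.of_norm_left ?_
    refine ((Asymptotics.isLittleO_pow_pow_atTop_of_lt (𝕜 := ℝ) (Finset.mem_Ico.1 hl).2).norm_left).congr_left
      fun u => ?_
    simp
  refine Asymptotics.IsBigO.of_bound 1 ?_
  filter_upwards [hlow.bound (c := 1 / (2 * d)) (by positivity), eventually_ge_atTop 1]
    with u hu hu1
  rw [one_mul, expNegPoly, Complex.norm_exp, Real.norm_eq_abs, Real.abs_exp, Real.exp_le_exp,
    Finset.sum_Ico_succ_top hd, hb]
  have hre := (Complex.abs_re_le_norm _).trans hu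
  have hmain : (1 / (d : ℂ) * (u : ℂ) ^ d).re = 1 / d * u ^ d := by
    rw [← Complex.ofReal_re (1 / d * u ^ d)]
    push_cast
    rfl
  have hpow : u ≤ u ^ d := le_self_pow₀ hu1 (by omega)
  rw [Real.norm_of_nonneg (by positivity)] at hre
  rw [Complex.neg_re, Complex.add_re, hmain]
  have h1 := (abs_le.1 hre).1
  have h2 : 1 / (2 * (d : ℝ)) * u ≤ 1 / (2 * d) * u ^ d := by gcongr
  have h3 : 1 / (d : ℝ) * u ^ d = 1 / (2 * d) * u ^ d + 1 / (2 * d) * u ^ d := by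
    field_simp
    ring
  linarith

lemma expNegPoly_isBigO_zero (d : ℕ) (b : ℕ → ℂ) :
    expNegPoly d b =O[𝓝[>] 0] fun u : ℝ => u ^ (-(0 : ℝ)) := by
  simp only [neg_zero, Real.rpow_zero]
  exact (((continuous_expNegPoly d b).tendsto 0).mono_left nhdsWithin_le_nhds).isBigO_one ℝ

lemma mellinConvergent_expNegPoly {d : ℕ} (hd : 1 ≤ d) {b : ℕ → ℂ} (hb : b d = 1) {s : ℂ}
    (hs : 0 < s.re) : MellinConvergent (expNegPoly d b) s :=
  mellinConvergent_of_isBigO_rpow_exp (by positivity)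
    ((continuous_expNegPoly d b).locallyIntegrable.locallyIntegrableOn _)
    (expNegPoly_isBigO_atTop hd hb) (expNegPoly_isBigO_zero d b) hs

lemma differentiableAt_mellin_expNegPoly {d : ℕ} (hd : 1 ≤ d) {b : ℕ → ℂ} (hb : b d = 1) {s : ℂ}
    (hs : 0 < s.re) : DifferentiableAt ℂ (mellin (expNegPoly d b)) s :=
  mellin_differentiableAt_of_isBigO_rpow_exp (by positivity)
    ((continuous_expNegPoly d b).locallyIntegrable.locallyIntegrableOn _)
    (expNegPoly_isBigO_atTop hd hb) (expNegPoly_isBigO_zero d b) hs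

lemma mul_mellin_expNegPoly {d : ℕ} (hd : 1 ≤ d) {b : ℕ → ℂ} (hb : b d = 1) {s : ℂ}
    (hs : 0 < s.re) : s * mellin (expNegPoly d b) s =
      ∑ l ∈ Finset.Ico 1 (d + 1), b l * mellin (expNegPoly d b) (s + l) := by
  have hs0 : s ≠ 0 := by rintro rfl; simp at hs
  set I : ℂ → ℝ → ℂ := fun z u => (u : ℂ) ^ (z - 1) • expNegPoly d b u with hI
  have hIint (l : ℕ) : IntegrableOn (I (s + l)) (Ioi 0) :=
    mellinConvergent_expNegPoly hd hb (by simp; linarith [(l.cast_nonneg : (0 : ℝ) ≤ l)])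
  have hIint0 : IntegrableOn (I s) (Ioi 0) := by simpa using hIint 0
  set D : ℝ → ℂ := fun u => s * I s u - ∑ l ∈ Finset.Ico 1 (d + 1), b l * I (s + l) u with hD
  have hsum : IntegrableOn (fun u => ∑ l ∈ Finset.Ico 1 (d + 1), b l * I (s + l) u) (Ioi 0) :=
    integrable_finsetSum _ fun l _ => (hIint l).const_mul (b l)
  have hDint : IntegrableOn D (Ioi 0) := (hIint0.const_mul s).sub hsum
  have hderiv : ∀ u ∈ Ioi (0 : ℝ),
      HasDerivAt (fun u : ℝ => (u : ℂ) ^ s * expNegPoly d b u) (D u) u := by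
    intro u hu
    have hu0 : (u : ℂ) ≠ 0 := Complex.ofReal_ne_zero.2 (ne_of_gt hu)
    have hpow : HasDerivAt (fun u : ℝ => (u : ℂ) ^ s) (s * (u : ℂ) ^ (s - 1)) u :=
      hasDerivAt_ofReal_cpow_const (ne_of_gt hu) hs0
    refine (hpow.mul (hasDerivAt_expNegPoly d b u)).congr_deriv (Eq.symm ?_)
    simp only [hD, hI, smul_eq_mul, Finset.mul_sum, mul_neg, sub_eq_add_neg, mul_assoc]
    congr 2
    refine Finset.sum_congr rfl fun l hl => ?_
    have hl1 := (Finset.mem_Ico.1 hl).1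
    have : (u : ℂ) ^ (s + l + -1) = (u : ℂ) ^ s * (u : ℂ) ^ (l - 1) := by
      rw [← Complex.cpow_natCast, ← Complex.cpow_add _ _ hu0]
      push_cast [hl1]
      congr 1
      ring
    rw [this]
    ring
  have hcont : Continuous (fun u : ℝ => (u : ℂ) ^ s * expNegPoly d b u) :=
    (Complex.continuous_ofReal_cpow_const hs).mul (continuous_expNegPoly d b)
  have hgint : IntegrableOn (fun u : ℝ => (u : ℂ) ^ s * expNegPoly d b u) (Ioi 0) := by
    simpa [hI] using hIint 1
  have hftc := integral_Ioi_of_hasDerivAt_of_tendsto hcont.continuousWithinAt hderiv hDint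
    (tendsto_zero_of_hasDerivAt_of_integrableOn_Ioi hderiv hDint hgint)
  rw [Complex.ofReal_zero, Complex.zero_cpow hs0, zero_mul, sub_zero, hD,
    integral_sub (hIint0.const_mul s) hsum,
    integral_finsetSum _ fun l _ => (hIint l).const_mul (b l), sub_eq_zero] at hftc
  simpa only [integral_const_mul, mellin, hI] using hftc

end Continuation

/-- Each `Ω_k` has a meromorphic extension `F_k` to `ℂ`, holomorphic off the
nonpositive integers, with at most simple poles at the nonpositive integers, satisfying the
functional equation `s·F_k(s) = F_k(s+d) + ∑_{l=1}^{d-1} α_l F_k(s+l)` where defined. -/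
theorem stmt1 (d : ℕ) (hd : 1 ≤ d) (a : ℕ → ℂ) (α : ℕ → ℂ)
    (hα : ∀ l, α l = -(l : ℂ) * a l)
    (k : ℕ) (hk : k ≤ d - 1) :
    ∃ F : ℂ → ℂ,
      (∀ s : ℂ, 0 < s.re → F s = OmegaFn d a k s) ∧
      DifferentiableOn ℂ F {s : ℂ | ∀ n : ℕ, s ≠ -(n : ℂ)} ∧
      (∀ n : ℕ, ∃ r : ℂ,
        Filter.Tendsto (fun s => (s + (n : ℂ)) * F s)
          (nhdsWithin (-(n : ℂ)) {(-(n : ℂ))}ᶜ) (nhds r)) ∧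
      (∀ s : ℂ, (∀ n : ℕ, s ≠ -(n : ℂ)) →
        s * F s = F (s + d) + ∑ l ∈ Finset.Ico 1 d, α l * F (s + l)) := by
  have hd0 : (d : ℂ) ≠ 0 := Nat.cast_ne_zero.2 (by omega)
  set θ : ℂ := 2 * Real.pi * Complex.I * k / d with hθ
  set c : ℕ → ℂ := fun l => if l = d then 1 else α l with hc
  set b : ℕ → ℂ := fun l => c l * Complex.exp θ ^ l with hb
  have hωd : Complex.exp θ ^ d = 1 := by
    rw [← Complex.exp_nat_mul, Complex.exp_eq_one_iff]
    exact ⟨k, by rw [hθ]; push_cast; field_simp⟩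
  have hbd : b d = 1 := by simp [hb, hc, hωd]
  have hsplit (G : ℕ → ℂ) : ∑ l ∈ Finset.Ico 1 (d + 1), c l * G l =
      G d + ∑ l ∈ Finset.Ico 1 d, α l * G l := by
    rw [Finset.sum_Ico_succ_top hd, add_comm]
    congr 1
    · simp [hc]
    · refine Finset.sum_congr rfl fun l hl => ?_
      simp [hc, (Finset.mem_Ico.1 hl).2.ne]
  have hP (u : ℝ) : Complex.exp (P0 d a (Complex.exp θ * u)) = expNegPoly d b u := by
    rw [P0, expNegPoly]
    congr 1
    have := hsplit fun l => Complex.exp θ ^ l / l * (u : ℂ) ^ l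
    simp only [hb, mul_pow, hωd] at this ⊢
    rw [Finset.sum_congr rfl fun l _ => show c l * Complex.exp θ ^ l / l * (u : ℂ) ^ l =
      c l * (Complex.exp θ ^ l / l * (u : ℂ) ^ l) by ring, this, neg_add, ← Finset.sum_neg_distrib]
    congr 1
    · ring
    · refine Finset.sum_congr rfl fun l hl => ?_
      have hl0 : (l : ℂ) ≠ 0 := Nat.cast_ne_zero.2 (by have := (Finset.mem_Ico.1 hl).1; omega)
      rw [hα]
      field_simp
  have hΩ : OmegaFn d a k = fun s => Complex.exp (θ * s) * mellin (expNegPoly d b) s := by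
    funext s
    simp only [OmegaFn, mellin, ← hθ, hP, smul_eq_mul]
    congr 2
    rw [hθ]
    ring
  obtain ⟨F, hF, hFd, hFp, hFeq⟩ := exists_meromorphic_extension (d := d) (c := c)
    (g := OmegaFn d a k)
    (fun s hs => by
      rw [hΩ]
      exact DifferentiableAt.mul (by fun_prop) (differentiableAt_mellin_expNegPoly hd hbd hs))
    (fun s hs => by
      rw [hΩ]
      beta_reduce
      rw [mul_left_comm, mul_mellin_expNegPoly hd hbd hs, Finset.mul_sum]
      refine Finset.sum_congr rfl fun l _ => ?_
      rw [mul_add, Complex.exp_add, mul_comm θ (l : ℂ), Complex.exp_nat_mul]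
      simp only [hb]
      ring)
  exact ⟨F, hF, hFd, hFp, fun s hs => (hFeq s hs).trans (hsplit fun l => F (s + l))⟩
end

section
/- Let (λ_n)_{n≥0} be the coefficients of the power series expansion e^{P_0(t)} = Σ_{n=0}^∞ λ_n t^n. Then for each 0 ≤ k ≤ d−1 and each integer n ≥ 0, the residue of the meromorphic continuation F_k of Ω_k at s = −n equals λ_n; that is, lim_{s→−n} (s+n)·F_k(s) = λ_n. -/
open Filter Topology Asymptotics MeasureTheory Set

/-- An open half plane with finitely many points of the negative real axis (or zero) removed is
preconnected. -/
theorem isPreconnected_halfPlane_diff {b : ℝ} (hb : b < 1) {S : Set ℂ}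
    (hS : S ⊆ Complex.slitPlaneᶜ) : IsPreconnected ({s : ℂ | b < s.re} ∩ Sᶜ) := by
  have hdense : Dense Complex.slitPlane := by
    intro z
    by_cases hz : z ∈ Complex.slitPlane
    · exact subset_closure hz
    have ht : Tendsto (fun ε : ℝ => z + ε * Complex.I) (𝓝[>] 0) (𝓝 z) := by
      have hc : Continuous fun ε : ℝ => z + ε * Complex.I := by fun_prop
      simpa using (hc.tendsto 0).mono_left nhdsWithin_le_nhds
    refine mem_closure_of_tendsto ht ?_
    filter_upwards [self_mem_nhdsWithin] with ε hε
    have him : z.im = 0 := by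
      by_contra h
      exact hz (Or.inr h)
    right
    simpa [him] using (ne_of_gt hε : ε ≠ 0)
  have hopen : IsOpen {s : ℂ | b < s.re} := isOpen_lt continuous_const Complex.continuous_re
  have hconv : Convex ℝ {s : ℂ | b < s.re} := convex_halfSpace_re_gt b
  have hstar : StarConvex ℝ (1 : ℂ) ({s : ℂ | b < s.re} ∩ Complex.slitPlane) :=
    (hconv.starConvex (by simpa using hb)).inter Complex.starConvex_one_slitPlane
  have hpre : IsPreconnected ({s : ℂ | b < s.re} ∩ Complex.slitPlane) :=
    (hstar.isPathConnected ⟨by simpa using hb, Complex.one_mem_slitPlane⟩).isConnected.isPreconnected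
  refine hpre.subset_closure ?_ ?_
  · rintro z ⟨h1, h2⟩
    exact ⟨h1, fun h => hS h h2⟩
  · exact inter_subset_left.trans (hdense.open_subset_closure_inter hopen)

theorem hasMellin_indicator_pow (m : ℕ) {s : ℂ} (hs : 0 < s.re) :
    HasMellin (indicator (Ioc 0 1) (fun t : ℝ => (t : ℂ) ^ m)) s (1 / (s + m)) := by
  simpa using hasMellin_cpow_Ioc (m : ℂ) (s := s) (by simp; positivity)

theorem hasMellin_sum_indicator_pow (c : ℕ → ℂ) (N : ℕ) {s : ℂ} (hs : 0 < s.re) :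
    HasMellin (fun t : ℝ => ∑ m ∈ Finset.range N,
      c m • indicator (Ioc 0 1) (fun t : ℝ => (t : ℂ) ^ m) t) s
      (∑ m ∈ Finset.range N, c m / (s + m)) := by
  induction N with
  | zero => simp [HasMellin, MellinConvergent, mellin]
  | succ N ih =>
    have h1 := hasMellin_indicator_pow N hs
    have h2 := hasMellin_const_smul h1.1 (c N)
    have h3 := hasMellin_add ih.1 h2.1
    rw [ih.2, h2.2, h1.2] at h3
    simpa [Finset.sum_range_succ, div_eq_mul_inv] using h3

/-- If `g` decays rapidly at infinity and has the Taylor expansion `∑ c m * u ^ m` up to order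
`n` at zero, then any continuation of `E * mellin g` has residue `E (-n) * c n` at `-n`. -/
theorem tendsto_residue_of_mellin {g : ℝ → ℂ} (hg : Continuous g)
    (htop : ∀ b : ℝ, g =O[atTop] fun x : ℝ => x ^ (-b)) (c : ℕ → ℂ) (n : ℕ)
    (hbot : (fun u : ℝ => g u - ∑ m ∈ Finset.range (n + 1), c m * (u : ℂ) ^ m)
      =O[𝓝[>] 0] fun u : ℝ => u ^ (n + 1))
    {E F : ℂ → ℂ} (hE : Differentiable ℂ E)
    (hFdiff : DifferentiableOn ℂ F {s : ℂ | ∀ n : ℕ, s ≠ -(n : ℂ)})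
    (hF : ∀ s : ℂ, 0 < s.re → F s = E s * mellin g s) :
    Tendsto (fun s => (s + n) * F s) (𝓝[≠] (-(n : ℂ))) (𝓝 (E (-n) * c n)) := by
  set q : ℝ → ℂ := fun t => ∑ m ∈ Finset.range (n + 1),
      c m • indicator (Ioc 0 1) (fun t : ℝ => (t : ℂ) ^ m) t with hq
  set h : ℝ → ℂ := fun t => g t - q t with hh
  have hloc : LocallyIntegrableOn h (Ioi 0) := by
    refine LocallyIntegrable.locallyIntegrableOn ?_ _
    refine hg.locallyIntegrable.sub ?_
    refine locallyIntegrable_finsetSum _ fun m _ => ?_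
    refine LocallyIntegrable.smul ?_ (c m)
    exact (Continuous.locallyIntegrable (by fun_prop)).indicator measurableSet_Ioc
  have h_top : ∀ b : ℝ, h =O[atTop] fun x : ℝ => x ^ (-b) := fun b => by
    refine (htop b).congr' ?_ EventuallyEq.rfl
    filter_upwards [eventually_gt_atTop 1] with t ht
    simp [hh, hq, ht.not_ge]
  have h_bot : h =O[𝓝[>] 0] fun x : ℝ => x ^ (-(-(n + 1 : ℝ))) := by
    refine hbot.congr' ?_ ?_
    · filter_upwards [Ioc_mem_nhdsGT one_pos] with t ht
      simp [hh, hq, ht]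
    · filter_upwards [self_mem_nhdsWithin] with t ht
      rw [neg_neg]
      exact_mod_cast (Real.rpow_natCast t (n + 1)).symm
  have hconv : ∀ s : ℂ, -(n + 1 : ℝ) < s.re → MellinConvergent h s := fun s hs =>
    mellinConvergent_of_isBigO_rpow hloc (h_top (s.re + 1)) (by linarith) h_bot hs
  have hdiff : ∀ s : ℂ, -(n + 1 : ℝ) < s.re → DifferentiableAt ℂ (mellin h) s := fun s hs =>
    mellin_differentiableAt_of_isBigO_rpow hloc (h_top (s.re + 1)) (by linarith) h_bot hs
  set G : ℂ → ℂ := fun s => E s * (mellin h s + ∑ m ∈ Finset.range (n + 1), c m / (s + m))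
    with hG
  set S : Set ℂ := (fun m : ℕ => -(m : ℂ)) '' (Finset.range (n + 1)) with hS
  set U : Set ℂ := {s : ℂ | -(n + 1 : ℝ) < s.re} ∩ Sᶜ with hU
  have hSfin : S.Finite := (Finset.finite_toSet _).image _
  have hhalf : IsOpen {s : ℂ | -(n + 1 : ℝ) < s.re} :=
    isOpen_lt continuous_const Complex.continuous_re
  have hUo : IsOpen U := hhalf.inter hSfin.isClosed.isOpen_compl
  have hFU : DifferentiableOn ℂ F U := by
    refine hFdiff.mono ?_
    rintro s ⟨h1, h2⟩ m rfl
    refine h2 ⟨m, ?_, rfl⟩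
    simp only [mem_ofPred_eq, Complex.neg_re, Complex.natCast_re, neg_lt_neg_iff] at h1
    simpa using (by exact_mod_cast h1 : m < n + 1)
  have hne : ∀ s ∈ U, ∀ m ∈ Finset.range (n + 1), s + m ≠ 0 := fun s hs m hm h0 =>
    hs.2 ⟨m, hm, (eq_neg_of_add_eq_zero_left h0).symm⟩
  have hGU : DifferentiableOn ℂ G U := by
    intro s hs
    refine DifferentiableAt.differentiableWithinAt ?_
    refine (hE s).mul ((hdiff s hs.1).add (DifferentiableAt.fun_sum fun m hm => ?_))
    exact (differentiableAt_const _).div (by fun_prop) (hne s hs m hm)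
  have hpos : ∀ s : ℂ, 0 < s.re → F s = G s := fun s hs => by
    have h1 := hasMellin_sum_indicator_pow c (n + 1) hs
    have h2 := hasMellin_add (hconv s (by have : (0 : ℝ) ≤ n := n.cast_nonneg; linarith)) h1.1
    have h3 : (fun t => h t + q t) = g := by
      funext t
      simp [hh]
    have h4 := h2.2
    rw [h1.2] at h4
    rw [hF s hs, ← h3]
    exact congrArg (E s * ·) h4
  have heq : EqOn F G U := by
    have hSslit : S ⊆ Complex.slitPlaneᶜ := by
      rintro _ ⟨m, -, rfl⟩
      simp [Complex.slitPlane]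
    have h1U : (1 : ℂ) ∈ U := by
      refine ⟨?_, fun h1 => hSslit h1 (by simp)⟩
      have : (0 : ℝ) ≤ n := n.cast_nonneg
      simp only [mem_ofPred_eq, Complex.one_re]
      linarith
    refine (hFU.analyticOnNhd hUo).eqOn_of_preconnected_of_eventuallyEq (hGU.analyticOnNhd hUo)
      (isPreconnected_halfPlane_diff (by have : (0 : ℝ) ≤ n := n.cast_nonneg; linarith) hSslit)
      h1U ?_
    filter_upwards [(isOpen_lt continuous_const Complex.continuous_re).mem_nhds
      (show (0 : ℝ) < (1 : ℂ).re by simp)] with s hs using hpos s hs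
  have hlim : Tendsto (fun s : ℂ =>
      E s * ((s + n) * (mellin h s + ∑ m ∈ Finset.range n, c m / (s + m)) + c n))
      (𝓝[≠] (-(n : ℂ))) (𝓝 (E (-n) * c n)) := by
    have hc : ContinuousAt (fun s : ℂ =>
        E s * ((s + n) * (mellin h s + ∑ m ∈ Finset.range n, c m / (s + m)) + c n))
        (-(n : ℂ)) := by
      refine DifferentiableAt.continuousAt (𝕜 := ℂ) ?_
      refine (hE _).mul (DifferentiableAt.add_const _ (DifferentiableAt.mul (by fun_prop)
        ((hdiff _ (by simp)).add (DifferentiableAt.fun_sum fun m hm => ?_))))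
      refine (differentiableAt_const _).div (by fun_prop) ?_
      have hmn : (m : ℂ) ≠ n := by exact_mod_cast (Finset.mem_range.mp hm).ne
      rw [neg_add_eq_sub]
      exact sub_ne_zero.mpr hmn
    simpa using hc.tendsto.mono_left nhdsWithin_le_nhds
  refine hlim.congr' ?_
  have hnear : ∀ᶠ s in 𝓝[≠] (-(n : ℂ)), s ∈ (S \ {-(n : ℂ)})ᶜ :=
    nhdsWithin_le_nhds ((hSfin.subset sdiff_subset).isClosed.isOpen_compl.mem_nhds (by simp))
  have hnear' : ∀ᶠ s in 𝓝[≠] (-(n : ℂ)), s ∈ {s : ℂ | -(n + 1 : ℝ) < s.re} :=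
    nhdsWithin_le_nhds (hhalf.mem_nhds (by simp))
  filter_upwards [hnear, hnear', self_mem_nhdsWithin] with s h1 h2 h3
  have hsU : s ∈ U := ⟨h2, fun h => h1 ⟨h, h3⟩⟩
  have hs0 := hne s hsU n (by simp)
  rw [heq hsU, hG]
  simp only [Finset.sum_range_succ]
  field_simp
  ring

/-- The remainder after `N` terms of an everywhere convergent power series is `O(t ^ N)`. -/
theorem isBigO_sub_sum_range_of_hasSum {lam : ℕ → ℂ} {f : ℂ → ℂ}
    (hlam : ∀ t : ℂ, HasSum (fun n : ℕ => lam n * t ^ n) (f t)) (N : ℕ) :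
    (fun t => f t - ∑ m ∈ Finset.range N, lam m * t ^ m) =O[𝓝 0] fun t => t ^ N := by
  have hsum : Summable fun m => ‖lam (m + N)‖ := by
    have h1 : Summable lam := by simpa using (hlam 1).summable
    exact (summable_nat_add_iff N).mpr h1.norm
  refine IsBigO.of_bound (∑' m, ‖lam (m + N)‖) ?_
  filter_upwards [Metric.ball_mem_nhds (0 : ℂ) one_pos] with t ht
  have ht1 : ‖t‖ ≤ 1 := (mem_ball_zero_iff.mp ht).le
  have h1 := (hasSum_nat_add_iff' N).mpr (hlam t)
  have h2 : HasSum (fun m => ‖lam (m + N)‖ * ‖t ^ N‖) ((∑' m, ‖lam (m + N)‖) * ‖t ^ N‖) :=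
    hsum.hasSum.mul_right _
  refine h1.norm_le_of_bounded h2 fun m => ?_
  rw [pow_add, norm_mul, norm_mul]
  gcongr
  have : ‖t ^ m‖ ≤ 1 := by
    rw [norm_pow]
    exact pow_le_one₀ (norm_nonneg _) ht1
  nlinarith [norm_nonneg (t ^ N)]

theorem isBigO_exp_P0_rpow {d : ℕ} (hd : 1 ≤ d) (a : ℕ → ℂ) {w : ℂ} (hw : w ^ d = 1) (b : ℝ) :
    (fun u : ℝ => Complex.exp (P0 d a (w * u))) =O[atTop] fun u : ℝ => u ^ (-b) := by
  have hd0 : (0 : ℝ) < d := by exact_mod_cast hd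
  have hsum : (fun u : ℝ => (∑ k ∈ Finset.Ico 1 d, a k * (w * u) ^ k).re + b * Real.log u)
      =o[atTop] fun u : ℝ => u ^ d := by
    refine IsLittleO.add ?_ ?_
    · have h1 : (fun u : ℝ => ∑ k ∈ Finset.Ico 1 d, a k * (w * u) ^ k)
          =o[atTop] fun u : ℝ => u ^ d := by
        refine IsLittleO.fun_sum fun k hk => ?_
        refine IsBigO.trans_isLittleO (g := fun u : ℝ => u ^ k) ?_
          (isLittleO_pow_pow_atTop_of_lt (Finset.mem_Ico.mp hk).2)
        refine IsBigO.of_bound ‖a k * w ^ k‖ (Eventually.of_forall fun u => le_of_eq ?_)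
        simp [mul_pow, mul_assoc]
      exact (IsBigO.of_bound 1 (Eventually.of_forall fun u => by
        rw [one_mul, Real.norm_eq_abs]
        exact Complex.abs_re_le_norm _)).trans_isLittleO h1
    · refine IsLittleO.const_mul_left ?_ b
      refine Real.isLittleO_log_id_atTop.trans_isBigO ?_
      refine IsBigO.of_bound 1 ?_
      filter_upwards [eventually_ge_atTop 1] with u hu
      have hu0 : 0 ≤ u := zero_le_one.trans hu
      rw [one_mul, id, Real.norm_of_nonneg hu0, Real.norm_of_nonneg (by positivity)]
      exact le_self_pow₀ hu (by omega)
  refine IsBigO.of_bound 1 ?_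
  filter_upwards [hsum.bound (inv_pos.mpr hd0), eventually_gt_atTop 0] with u hu hu0
  rw [Complex.norm_exp, one_mul, Real.norm_of_nonneg (by positivity),
    Real.rpow_def_of_pos hu0, Real.exp_le_exp]
  rw [Real.norm_of_nonneg (by positivity : 0 ≤ u ^ d)] at hu
  have hre : (-(w * u) ^ d / (d : ℂ)).re = -((d : ℝ)⁻¹ * u ^ d) := by
    rw [mul_pow, hw, one_mul]
    have : (-(u : ℂ) ^ d / (d : ℂ)) = ((-((d : ℝ)⁻¹ * u ^ d) : ℝ) : ℂ) := by
      push_cast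
      ring
    rw [this, Complex.ofReal_re]
  rw [P0, Complex.add_re, hre]
  have := (le_abs_self _).trans hu
  linarith

/-- If `e^{P₀(t)} = ∑_{n≥0} λ_n t^n`, then the residue of the meromorphic
continuation `F_k` of `Ω_k` at `s = -n` equals `λ_n`: `lim_{s→-n} (s+n)·F_k(s) = λ_n`. -/
theorem stmt3 (d : ℕ) (hd : 1 ≤ d) (a : ℕ → ℂ) (k : ℕ) (hk : k ≤ d - 1)
    (F : ℂ → ℂ)
    (hFdiff : DifferentiableOn ℂ F {s : ℂ | ∀ n : ℕ, s ≠ -(n : ℂ)})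
    (hFΩ : ∀ s : ℂ, 0 < s.re → F s = OmegaFn d a k s)
    (lam : ℕ → ℂ)
    (hlam : ∀ t : ℂ, HasSum (fun n : ℕ => lam n * t ^ n) (Complex.exp (P0 d a t)))
    (n : ℕ) :
    Filter.Tendsto (fun s => (s + (n : ℂ)) * F s)
      (nhdsWithin (-(n : ℂ)) {(-(n : ℂ))}ᶜ) (nhds (lam n)) := by
  have hd0 : (d : ℂ) ≠ 0 := by exact_mod_cast (by omega : d ≠ 0)
  set w : ℂ := Complex.exp (2 * Real.pi * Complex.I * k / d) with hw
  have hwd : w ^ d = 1 := by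
    rw [hw, ← Complex.exp_nat_mul, Complex.exp_eq_one_iff]
    refine ⟨k, ?_⟩
    push_cast
    field_simp
  have hbot : (fun u : ℝ => Complex.exp (P0 d a (w * u)) -
      ∑ m ∈ Finset.range (n + 1), lam m * w ^ m * (u : ℂ) ^ m)
      =O[nhdsWithin 0 (Ioi 0)] fun u : ℝ => u ^ (n + 1) := by
    have hc : Continuous fun u : ℝ => w * (u : ℂ) := by fun_prop
    have ht : Tendsto (fun u : ℝ => w * (u : ℂ)) (nhdsWithin 0 (Ioi 0)) (nhds 0) := by
      simpa using (hc.tendsto 0).mono_left nhdsWithin_le_nhds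
    have h1 := (isBigO_sub_sum_range_of_hasSum hlam (n + 1)).comp_tendsto ht
    have h2 : (fun u : ℝ => (w * (u : ℂ)) ^ (n + 1)) =O[nhdsWithin 0 (Ioi 0)]
        fun u : ℝ => u ^ (n + 1) :=
      IsBigO.of_bound ‖w ^ (n + 1)‖ (Eventually.of_forall fun u => le_of_eq (by simp [mul_pow]))
    refine (h1.trans h2).congr_left fun u => ?_
    simp [mul_pow, mul_assoc]
  have hcont : Continuous fun u : ℝ => Complex.exp (P0 d a (w * u)) := by
    unfold P0
    fun_prop
  have hE : Differentiable ℂ fun s : ℂ => Complex.exp (2 * Real.pi * Complex.I * k * s / d) := by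
    fun_prop
  have key := tendsto_residue_of_mellin hcont (isBigO_exp_P0_rpow hd a hwd)
    (fun m => lam m * w ^ m) n hbot hE hFdiff fun s hs => hFΩ s hs
  have hval : Complex.exp (2 * Real.pi * Complex.I * k * -(n : ℂ) / d) * (lam n * w ^ n)
      = lam n := by
    rw [hw, ← Complex.exp_nat_mul, mul_left_comm, ← Complex.exp_add]
    have : 2 * Real.pi * Complex.I * k * -(n : ℂ) / d
        + n * (2 * Real.pi * Complex.I * k / d) = 0 := by ring
    rw [this, Complex.exp_zero, mul_one]
  rw [hval] at key
  exact key
end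

section
/- Mittag-Leffler decomposition: let (λ_n)_{n≥0} be the Taylor coefficients of e^{P_0(t)} = Σ_{n=0}^∞ λ_n t^n. For each 0 ≤ k ≤ d−1 there exists an entire function G_k : ℂ → ℂ such that for every s ∈ ℂ ∖ {0, −1, −2, …}, the series Σ_{n=0}^∞ λ_n/(s+n) converges and F_k(s) = Σ_{n=0}^∞ λ_n/(s+n) + G_k(s); moreover for Re s > 0 one has G_k(s) = Ω_k(s) − ∫_0^1 u^{s−1} e^{P_0(u)} du. -/
open Set Filter Topology MeasureTheory

theorem P0_continuous (d : ℕ) (a : ℕ → ℂ) : Continuous (P0 d a) := by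
  unfold P0
  fun_prop

/-- Along a ray through a `d`-th root of unity, `e^{P₀}` decays at least exponentially. -/
theorem exp_P0_ray_isBigO {d : ℕ} (hd : 1 ≤ d) (a : ℕ → ℂ) {w : ℂ} (hw : w ^ d = 1) :
    (fun u : ℝ => Complex.exp (P0 d a (w * u))) =O[atTop]
      fun u : ℝ => Real.exp (-(1 / (2 * d)) * u) := by
  have hd0 : (0 : ℝ) < d := by exact_mod_cast hd
  have ho : (fun u : ℝ => ∑ k ∈ Finset.Ico 1 d, a k * (w * (u : ℂ)) ^ k) =o[atTop]
      fun u : ℝ => u ^ d := by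
    refine Asymptotics.IsLittleO.fun_sum fun k hk => ?_
    have h1 : (fun u : ℝ => u ^ k) =o[atTop] fun u : ℝ => u ^ d :=
      Asymptotics.isLittleO_pow_pow_atTop_of_lt (Finset.mem_Ico.1 hk).2
    have h2 : (fun u : ℝ => a k * (w * (u : ℂ)) ^ k) =O[atTop] fun u : ℝ => u ^ k := by
      refine Asymptotics.IsBigO.of_bound (‖a k‖ * ‖w‖ ^ k) (Eventually.of_forall fun u => ?_)
      simp [mul_pow, mul_assoc]
    exact h2.trans_isLittleO h1
  refine Asymptotics.IsBigO.of_bound 1 ?_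
  have hc : (0 : ℝ) < 1 / (2 * d) := by positivity
  filter_upwards [ho.def hc, eventually_ge_atTop 1] with u hu hu1
  rw [Complex.norm_exp, one_mul, Real.norm_eq_abs, Real.abs_exp, Real.exp_le_exp]
  have hupos : (0 : ℝ) ≤ u ^ d := by positivity
  have hle : u ≤ u ^ d := le_self_pow₀ hu1 (by omega)
  have hre : (P0 d a (w * u)).re
      = -(u ^ d) / d + (∑ k ∈ Finset.Ico 1 d, a k * (w * (u : ℂ)) ^ k).re := by
    have : (-(w * (u : ℂ)) ^ d / (d : ℂ)) = ((-(u ^ d) / d : ℝ) : ℂ) := by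
      rw [mul_pow, hw]
      push_cast
      ring
    rw [P0, this, Complex.add_re, Complex.ofReal_re]
  rw [Real.norm_eq_abs, abs_of_nonneg hupos] at hu
  have h3 := (Complex.re_le_norm (∑ k ∈ Finset.Ico 1 d, a k * (w * (u : ℂ)) ^ k)).trans hu
  have h4 : -(u ^ d) / d = -(1 / (2 * d)) * u ^ d - 1 / (2 * d) * u ^ d := by
    field_simp
    ring
  have h5 : 1 / (2 * (d : ℝ)) * u ≤ 1 / (2 * d) * u ^ d := by gcongr
  rw [hre, h4]
  linarith

/-- The incomplete Mellin transform over `(1, ∞)` is entire when the function is continuous and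
decays exponentially. -/
theorem differentiable_integral_Ioi_one {g : ℝ → ℂ} (hg : Continuous g) {c : ℝ} (hc : 0 < c)
    (hO : g =O[atTop] fun u : ℝ => Real.exp (-c * u)) :
    (Differentiable ℂ fun s : ℂ => ∫ u in Ioi (1 : ℝ), (u : ℂ) ^ (s - 1) * g u) ∧
      ∀ s : ℂ, IntegrableOn (fun u : ℝ => (u : ℂ) ^ (s - 1) * g u) (Ioi 1) := by
  have hloc : LocallyIntegrableOn ((Ioi (1 : ℝ)).indicator g) (Ioi 0) := by
    refine LocallyIntegrable.locallyIntegrableOn ?_ _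
    intro x
    obtain ⟨t, ht, hi⟩ := hg.locallyIntegrable (μ := volume) x
    exact ⟨t, ht, hi.indicator measurableSet_Ioi⟩
  have htop : (Ioi (1 : ℝ)).indicator g =O[atTop] fun u : ℝ => Real.exp (-c * u) := by
    refine hO.congr' ?_ EventuallyEq.rfl
    filter_upwards [eventually_gt_atTop 1] with u hu
    rw [indicator_of_mem (mem_Ioi.2 hu)]
  have hbot (b : ℝ) : (Ioi (1 : ℝ)).indicator g =O[𝓝[>] 0] fun u : ℝ => u ^ (-b) := by
    refine (Asymptotics.isBigO_zero _ _).congr' ?_ EventuallyEq.rfl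
    filter_upwards [mem_nhdsWithin_of_mem_nhds (Iio_mem_nhds (zero_lt_one' ℝ))] with u hu
    rw [indicator_of_notMem (by simpa using le_of_lt hu)]
  have hfun (s : ℂ) : (fun u : ℝ => (u : ℂ) ^ (s - 1) • (Ioi (1 : ℝ)).indicator g u)
      = (Ioi (1 : ℝ)).indicator fun u : ℝ => (u : ℂ) ^ (s - 1) * g u := by
    ext u
    by_cases hu : u ∈ Ioi (1 : ℝ) <;> simp [hu]
  have hsub : Ioi (0 : ℝ) ∩ Ioi 1 = Ioi 1 :=
    inter_eq_self_of_subset_right (Ioi_subset_Ioi zero_le_one)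
  have hmel : mellin ((Ioi (1 : ℝ)).indicator g)
      = fun s : ℂ => ∫ u in Ioi (1 : ℝ), (u : ℂ) ^ (s - 1) * g u := by
    ext s
    rw [mellin, hfun, setIntegral_indicator measurableSet_Ioi, hsub]
  refine ⟨?_, fun s => ?_⟩
  · rw [← hmel]
    intro s
    exact mellin_differentiableAt_of_isBigO_rpow_exp hc hloc htop (hbot (s.re - 1))
      (sub_one_lt s.re)
  · have h := mellinConvergent_of_isBigO_rpow_exp hc hloc htop (hbot (s.re - 1))
      (sub_one_lt s.re)
    rw [MellinConvergent, hfun, integrableOn_indicator_iff measurableSet_Ioi, inter_comm,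
      hsub] at h
    exact h

/-- Termwise Mellin transform over `(0, 1)` of a power series evaluated along a ray. -/
theorem hasSum_integral_zero_one {lam : ℕ → ℂ} {f : ℂ → ℂ}
    (hlam : ∀ t : ℂ, HasSum (fun n : ℕ => lam n * t ^ n) (f t)) {w : ℂ} (hw : ‖w‖ = 1)
    {s : ℂ} (hs : 0 < s.re) :
    HasSum (fun n : ℕ => lam n * w ^ n / (s + n))
      (∫ u in (0 : ℝ)..1, (u : ℂ) ^ (s - 1) * f (w * u)) := by
  have hsum : Summable fun n => ‖lam n‖ := by simpa using (hlam 1).summable.norm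
  have hIoc : uIoc (0 : ℝ) 1 = Ioc 0 1 := uIoc_of_le zero_le_one
  have hint (n : ℕ) : (∫ u in (0 : ℝ)..1, lam n * w ^ n * (u : ℂ) ^ (s + n - 1))
      = lam n * w ^ n / (s + n) := by
    have hre : 0 < (s + n).re := by
      simp only [Complex.add_re, Complex.natCast_re]
      positivity
    have hne : s + n ≠ 0 := by
      intro h
      simp [h] at hre
    rw [intervalIntegral.integral_const_mul, integral_cpow (Or.inl (by
      rw [Complex.sub_re, Complex.one_re]; linarith))]
    simp [Complex.zero_cpow hne, div_eq_mul_inv]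
  have key := intervalIntegral.hasSum_integral_of_dominated_convergence (μ := volume)
    (a := 0) (b := 1) (F := fun (n : ℕ) (u : ℝ) => lam n * w ^ n * (u : ℂ) ^ (s + n - 1))
    (f := fun u : ℝ => (u : ℂ) ^ (s - 1) * f (w * u))
    (fun n u => ‖lam n‖ * u ^ (s.re - 1)) ?_ ?_ ?_ ?_ ?_
  · simpa only [hint] using key
  · intro n
    refine (Measurable.aestronglyMeasurable ?_)
    fun_prop
  · refine fun n => Eventually.of_forall fun u hu => ?_
    rw [hIoc] at hu
    rw [norm_mul, norm_mul, norm_pow, hw, one_pow, mul_one,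
      Complex.norm_cpow_eq_rpow_re_of_pos hu.1]
    refine mul_le_mul_of_nonneg_left ?_ (norm_nonneg _)
    refine Real.rpow_le_rpow_of_exponent_ge hu.1 hu.2 ?_
    simp
  · exact Eventually.of_forall fun u _ => hsum.mul_right _
  · simp only [tsum_mul_right]
    exact (intervalIntegral.intervalIntegrable_rpow' (by linarith)).const_mul _
  · refine Eventually.of_forall fun u hu => ?_
    rw [hIoc] at hu
    have hu0 : (u : ℂ) ≠ 0 := by exact_mod_cast hu.1.ne'
    refine ((hlam (w * u)).mul_left ((u : ℂ) ^ (s - 1))).congr_fun ?_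
    intro n
    rw [show s + n - 1 = (s - 1) + n by ring, Complex.cpow_add _ _ hu0, Complex.cpow_natCast]
    ring

/-- The integral over a circular arc of a Mellin integrand is entire in the exponent. -/
theorem differentiable_integral_arc {g : ℝ → ℂ} (hg : Continuous g) (θ : ℝ) :
    Differentiable ℂ fun s : ℂ =>
      ∫ φ in (0 : ℝ)..θ, Complex.I * Complex.exp (Complex.I * φ * s) * g φ := by
  intro s₀
  obtain ⟨C, hC⟩ := ((isCompact_closedBall s₀ 1).prod (isCompact_uIcc (a := (0 : ℝ)) (b := θ))
    ).exists_bound_of_continuousOn (f := fun p : ℂ × ℝ =>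
      Complex.I * (Complex.exp (Complex.I * p.2 * p.1) * (Complex.I * p.2)) * g p.2)
      (Continuous.continuousOn (by fun_prop))
  refine (intervalIntegral.hasDerivAt_integral_of_dominated_loc_of_deriv_le (μ := volume)
    (F' := fun s φ => Complex.I * (Complex.exp (Complex.I * φ * s) * (Complex.I * φ)) * g φ)
    (bound := fun _ => C) (Metric.closedBall_mem_nhds s₀ one_pos) ?_ ?_ ?_ ?_ ?_
    ?_).2.differentiableAt
  · exact Eventually.of_forall fun s => (Continuous.aestronglyMeasurable (by fun_prop))
  · exact Continuous.intervalIntegrable (by fun_prop) _ _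
  · exact Continuous.aestronglyMeasurable (by fun_prop)
  · exact Eventually.of_forall fun φ hφ s hs => hC (s, φ) ⟨hs, uIoc_subset_uIcc hφ⟩
  · exact intervalIntegrable_const
  · refine Eventually.of_forall fun φ _ s _ => ?_
    have h := ((hasDerivAt_id s).const_mul (Complex.I * φ)).cexp
    simpa using (h.const_mul Complex.I).mul_const (g φ)

/-- Termwise integration over a circular arc of a power series against `t^{s-1}`. -/
theorem hasSum_integral_arc {lam : ℕ → ℂ} {f : ℂ → ℂ}
    (hlam : ∀ t : ℂ, HasSum (fun n : ℕ => lam n * t ^ n) (f t)) (θ : ℝ) {s : ℂ}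
    (hs : ∀ n : ℕ, s + n ≠ 0) :
    HasSum (fun n : ℕ => lam n * (Complex.exp (Complex.I * θ * (s + n)) - 1) / (s + n))
      (∫ φ in (0 : ℝ)..θ,
        Complex.I * Complex.exp (Complex.I * φ * s) * f (Complex.exp (Complex.I * φ))) := by
  have hsum : Summable fun n => ‖lam n‖ := by simpa using (hlam 1).summable.norm
  have hint (n : ℕ) : (∫ φ in (0 : ℝ)..θ,
      lam n * Complex.I * Complex.exp (Complex.I * (s + n) * φ))
      = lam n * (Complex.exp (Complex.I * θ * (s + n)) - 1) / (s + n) := by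
    rw [intervalIntegral.integral_const_mul,
      integral_exp_mul_complex (mul_ne_zero Complex.I_ne_zero (hs n))]
    have := hs n
    have hI := Complex.I_ne_zero
    rw [show Complex.I * (s + n) * (θ : ℂ) = Complex.I * θ * (s + n) by ring]
    simp only [Complex.ofReal_zero, mul_zero, Complex.exp_zero]
    field_simp
  have key := intervalIntegral.hasSum_integral_of_dominated_convergence (μ := volume)
    (a := 0) (b := θ)
    (F := fun (n : ℕ) (φ : ℝ) => lam n * Complex.I * Complex.exp (Complex.I * (s + n) * φ))
    (f := fun φ : ℝ =>
      Complex.I * Complex.exp (Complex.I * φ * s) * f (Complex.exp (Complex.I * φ)))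
    (fun n φ => ‖lam n‖ * ‖Complex.exp (Complex.I * φ * s)‖) ?_ ?_ ?_ ?_ ?_
  · simpa only [hint] using key
  · exact fun n => Continuous.aestronglyMeasurable (by fun_prop)
  · refine fun n => Eventually.of_forall fun φ _ => le_of_eq ?_
    simp [Complex.norm_exp, mul_comm]
  · exact Eventually.of_forall fun φ _ => hsum.mul_right _
  · simp only [tsum_mul_right]
    exact Continuous.intervalIntegrable (by fun_prop) _ _
  · refine Eventually.of_forall fun φ _ => ?_
    refine ((hlam (Complex.exp (Complex.I * φ))).mul_left
      (Complex.I * Complex.exp (Complex.I * φ * s))).congr_fun ?_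
    intro n
    rw [← Complex.exp_nat_mul, show Complex.I * (s + n) * (φ : ℂ)
      = Complex.I * φ * s + n * (Complex.I * φ) by ring, Complex.exp_add]
    ring

theorem isClosed_range_neg_natCast : IsClosed (range fun n : ℕ => -(n : ℂ)) := by
  have h : IsClosedEmbedding fun n : ℕ => -(((n : ℝ) : ℂ)) :=
    (Homeomorph.neg ℂ).isClosedEmbedding.comp
      (Complex.isometry_ofReal.isClosedEmbedding.comp Nat.isClosedEmbedding_coe_real)
  simpa using h.isClosed_range

/-- A series of simple poles at the nonpositive integers with absolutely summable residues
converges and is holomorphic away from the poles. -/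
theorem summable_and_differentiableAt_tsum_div_add_nat {lam : ℕ → ℂ}
    (hsum : Summable fun n => ‖lam n‖) {s : ℂ} (hs : s ∉ range fun n : ℕ => -(n : ℂ)) :
    (Summable fun n : ℕ => lam n / (s + n)) ∧
      DifferentiableAt ℂ (fun z : ℂ => ∑' n : ℕ, lam n / (z + n)) s := by
  obtain ⟨ε, hε, hball⟩ := Metric.isOpen_iff.1 isClosed_range_neg_natCast.isOpen_compl s hs
  have hlow : ∀ (n : ℕ), ∀ z ∈ Metric.ball s (ε / 2), ε / 2 ≤ ‖z + n‖ := by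
    intro n z hz
    by_contra! h
    refine hball (a := -(n : ℂ)) ?_ ⟨n, rfl⟩
    rw [Metric.mem_ball] at hz ⊢
    have h1 : dist (-(n : ℂ)) z = ‖z + n‖ := by rw [dist_comm, dist_eq_norm, sub_neg_eq_add]
    linarith [dist_triangle (-(n : ℂ)) z s]
  have hbd : ∀ (n : ℕ), ∀ z ∈ Metric.ball s (ε / 2), ‖lam n / (z + n)‖ ≤ ‖lam n‖ / (ε / 2) := by
    intro n z hz
    rw [norm_div]
    exact div_le_div_of_nonneg_left (norm_nonneg _) (half_pos hε) (hlow n z hz)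
  have hmem : s ∈ Metric.ball s (ε / 2) := Metric.mem_ball_self (half_pos hε)
  refine ⟨Summable.of_norm_bounded (hsum.div_const _) fun n => hbd n s hmem, ?_⟩
  refine (Complex.differentiableOn_tsum_of_summable_norm (hsum.div_const (ε / 2)) (fun n z hz => ?_)
    Metric.isOpen_ball hbd).differentiableAt (Metric.isOpen_ball.mem_nhds hmem)
  have hne : z + n ≠ 0 := norm_pos_iff.1 ((half_pos hε).trans_le (hlow n z hz))
  exact ((differentiableAt_const _).div (differentiableAt_fun_id.add_const (n : ℂ)) hne).differentiableWithinAt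

/-- Mittag-Leffler decomposition. If `e^{P₀(t)} = ∑_{n≥0} λ_n t^n`, then there is
an entire function `G_k` such that for every `s` off the nonpositive integers the series
`∑_{n≥0} λ_n/(s+n)` converges with `F_k(s) = ∑_{n≥0} λ_n/(s+n) + G_k(s)`; moreover for
`Re s > 0`, `G_k(s) = Ω_k(s) - ∫_0^1 u^{s-1} e^{P₀(u)} du`. -/
theorem stmt4 (d : ℕ) (hd : 1 ≤ d) (a : ℕ → ℂ) (k : ℕ) (hk : k ≤ d - 1)
    (F : ℂ → ℂ)
    (hFdiff : DifferentiableOn ℂ F {s : ℂ | ∀ n : ℕ, s ≠ -(n : ℂ)})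
    (hFΩ : ∀ s : ℂ, 0 < s.re → F s = OmegaFn d a k s)
    (lam : ℕ → ℂ)
    (hlam : ∀ t : ℂ, HasSum (fun n : ℕ => lam n * t ^ n) (Complex.exp (P0 d a t))) :
    ∃ G : ℂ → ℂ, Differentiable ℂ G ∧
      (∀ s : ℂ, (∀ n : ℕ, s ≠ -(n : ℂ)) →
        HasSum (fun n : ℕ => lam n / (s + n)) (F s - G s)) ∧
      (∀ s : ℂ, 0 < s.re →
        G s = OmegaFn d a k s
          - ∫ u in (0 : ℝ)..1, (u : ℂ) ^ (s - 1) * Complex.exp (P0 d a u)) := by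
  have hd0 : (d : ℂ) ≠ 0 := by exact_mod_cast (by omega : d ≠ 0)
  have hsum : Summable fun n => ‖lam n‖ := by simpa using (hlam 1).summable.norm
  set θ : ℝ := 2 * Real.pi * k / d with hθ
  set w : ℂ := Complex.exp (Complex.I * θ) with hw
  have hww : Complex.exp (2 * Real.pi * Complex.I * k / d) = w := by
    rw [hw, hθ]
    push_cast
    congr 1
    ring
  have hwd : w ^ d = 1 := by
    rw [hw, ← Complex.exp_nat_mul, hθ]
    refine Complex.exp_eq_one_iff.2 ⟨k, ?_⟩
    push_cast
    field_simp
  have hwn : ‖w‖ = 1 := by simp [hw, Complex.norm_exp]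
  have hOm (s : ℂ) : Complex.exp (2 * Real.pi * Complex.I * k * s / d)
      = Complex.exp (Complex.I * θ * s) := by
    rw [hθ]
    push_cast
    congr 1
    ring
  have hcont : Continuous fun t => Complex.exp (P0 d a t) :=
    Complex.continuous_exp.comp (P0_continuous d a)
  have hray : Continuous fun u : ℝ => Complex.exp (P0 d a (w * u)) := by
    exact hcont.comp (by fun_prop)
  have harc : Continuous fun φ : ℝ => Complex.exp (P0 d a (Complex.exp (Complex.I * φ))) := by
    exact hcont.comp (by fun_prop)
  obtain ⟨hTdiff, hTint⟩ := differentiable_integral_Ioi_one hray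
    (by positivity : (0 : ℝ) < 1 / (2 * d)) (exp_P0_ray_isBigO hd a hwd)
  have hAdiff := differentiable_integral_arc harc θ
  set T : ℂ → ℂ := fun s =>
    ∫ u in Ioi (1 : ℝ), (u : ℂ) ^ (s - 1) * Complex.exp (P0 d a (w * u)) with hT
  set A : ℂ → ℂ := fun s => ∫ φ in (0 : ℝ)..θ, Complex.I * Complex.exp (Complex.I * φ * s) *
    Complex.exp (P0 d a (Complex.exp (Complex.I * φ))) with hA
  let G : ℂ → ℂ := fun s => Complex.exp (Complex.I * θ * s) * T s + A s
  have hGdiff : Differentiable ℂ G := by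
    refine Differentiable.add (Differentiable.mul ?_ hTdiff) hAdiff
    fun_prop
  have hne_of_re {s : ℂ} (hs : 0 < s.re) (n : ℕ) : s + n ≠ 0 := by
    intro h
    have h' := congrArg Complex.re h
    simp only [Complex.add_re, Complex.natCast_re, Complex.zero_re] at h'
    have : (0 : ℝ) ≤ n := n.cast_nonneg
    linarith
  have hsplit {s : ℂ} (hs : 0 < s.re) : F s = Complex.exp (Complex.I * θ * s) *
      ((∫ u in (0 : ℝ)..1, (u : ℂ) ^ (s - 1) * Complex.exp (P0 d a (w * u))) + T s) := by
    rw [hFΩ s hs, OmegaFn, hOm, hww, hT]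
    have hint : IntegrableOn (fun u : ℝ => (u : ℂ) ^ (s - 1) * Complex.exp (P0 d a (w * u)))
        (Ioc 0 1) := by
      rw [← intervalIntegrable_iff_integrableOn_Ioc_of_le zero_le_one]
      refine (intervalIntegral.intervalIntegrable_cpow' ?_).mul_continuousOn hray.continuousOn
      rw [Complex.sub_re, Complex.one_re]
      linarith
    rw [intervalIntegral.integral_of_le zero_le_one, ← Ioc_union_Ioi_eq_Ioi (zero_le_one' ℝ),
      setIntegral_union Ioc_disjoint_Ioi_same measurableSet_Ioi hint (hTint s)]
  have hright {s : ℂ} (hs : 0 < s.re) : HasSum (fun n : ℕ => lam n / (s + n)) (F s - G s) := by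
    have h1 := (hasSum_integral_zero_one hlam hwn hs).mul_left (Complex.exp (Complex.I * θ * s))
    have h2 := hasSum_integral_arc hlam θ (hne_of_re hs)
    have hval : F s - G s = Complex.exp (Complex.I * θ * s) *
        (∫ u in (0 : ℝ)..1, (u : ℂ) ^ (s - 1) * Complex.exp (P0 d a (w * u))) - A s := by
      rw [hsplit hs]
      simp only [G]
      ring
    rw [hval]
    refine (h1.sub h2).congr_fun fun n => ?_
    have := hne_of_re hs n
    rw [hw, ← Complex.exp_nat_mul, mul_add (Complex.I * (θ : ℂ)), Complex.exp_add,
      mul_comm (n : ℂ) (Complex.I * θ)]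
    field_simp
    ring
  have hset : {s : ℂ | ∀ n : ℕ, s ≠ -(n : ℂ)} = (range fun n : ℕ => -(n : ℂ))ᶜ := by
    ext s
    simp [eq_comm]
  rw [hset] at hFdiff
  have hopen := isClosed_range_neg_natCast.isOpen_compl
  have hconn : IsPreconnected (range fun n : ℕ => -(n : ℂ))ᶜ :=
    ((countable_range _).isConnected_compl_of_one_lt_rank (by
      rw [Complex.rank_real_complex]; exact Nat.one_lt_ofNat)).isPreconnected
  have hMdiff : DifferentiableOn ℂ (fun z : ℂ => ∑' n : ℕ, lam n / (z + n))
      (range fun n : ℕ => -(n : ℂ))ᶜ := fun s hs =>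
    (summable_and_differentiableAt_tsum_div_add_nat hsum hs).2.differentiableWithinAt
  have hone : (1 : ℂ) ∈ (range fun n : ℕ => -(n : ℂ))ᶜ := by
    rintro ⟨n, hn⟩
    refine hne_of_re (s := 1) (by simp) n ?_
    rw [← hn]
    simp
  have heq : EqOn (fun z : ℂ => ∑' n : ℕ, lam n / (z + n)) (fun z => F z - G z)
      (range fun n : ℕ => -(n : ℂ))ᶜ := by
    refine AnalyticOnNhd.eqOn_of_preconnected_of_eventuallyEq (hMdiff.analyticOnNhd hopen)
      ((hFdiff.sub hGdiff.differentiableOn).analyticOnNhd hopen) hconn hone ?_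
    filter_upwards [(isOpen_lt continuous_const Complex.continuous_re).mem_nhds
      (show (0 : ℝ) < (1 : ℂ).re by simp)] with s hs
    exact (hright hs).tsum_eq
  refine ⟨G, hGdiff, fun s hs => ?_, fun s hs => ?_⟩
  · have hs' : s ∈ (range fun n : ℕ => -(n : ℂ))ᶜ := hset ▸ hs
    have h := (summable_and_differentiableAt_tsum_div_add_nat hsum hs').1.hasSum
    rwa [show ∑' n : ℕ, lam n / (s + n) = F s - G s from heq hs'] at h
  · have h := hasSum_integral_zero_one hlam (w := 1) (by simp) hs
    simp only [one_pow, mul_one, one_mul] at h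
    rw [h.unique (hright hs), hFΩ s hs]
    ring
end
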